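/- arXiv:2005.03262 — 6 statements merged into one kernel-verified Lean document; each statement's English description precedes it below -/
import Mathlib

section
/- Lower bound by Jensen's inequality: for every divergence-free q̄ ∈ M(E), every T > 0 and every (ρ,q) ∈ A_{T,m}(q̄), one has (1/T) I_{[0,T]}(ρ,q) ≥ Σ_{(x,y)∈E} s(q̄_{x,y} | (1/T)∫_0^T k_{x,y}(ρ(t)) dt) ≥ Ψ⁻_m(q̄). Consequently Ψ⁻_m(q̄) ≤ Ψ_m(q̄) ≤ Ψ⁺_m(q̄). -/
open MeasureTheory Filter Set
open scoped Classical ENNReal NNReal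

/-- The Boltzmann entropy function `s(a|b)`, with values in `[0,∞]`. -/
noncomputable def entS (a b : ℝ) : ℝ≥0∞ :=
  if 0 < a ∧ 0 < b then ENNReal.ofReal (a * Real.log (a / b) - a + b)
  else if a = 0 ∧ 0 ≤ b then ENNReal.ofReal b
  else ⊤

/-- Real-valued entropy function `s(a|b) = a log(a/b) - a + b` (used when `a,b > 0`). -/
noncomputable def sR (a b : ℝ) : ℝ := a * Real.log (a / b) - a + b

/-- `M_m(X)`: nonnegative measures on `X` of total mass `m`. -/
def Mmass {X : Type*} [Fintype X] (m : ℝ) : Set (X → ℝ) :=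
  {ρ | (∀ x, 0 ≤ ρ x) ∧ ∑ x, ρ x = m}

/-- `M(E)`: nonnegative flows on the edge set `E`. -/
def MFlow {X : Type*} (E : Finset (X × X)) : Set ((X × X) → ℝ) :=
  {w | ∀ e ∈ E, 0 ≤ w e}

/-- Discrete divergence of a flow. -/
def divFlow {X : Type*} [DecidableEq X] (E : Finset (X × X)) (w : (X × X) → ℝ) (x : X) : ℝ :=
  ∑ e ∈ E, ((if e.1 = x then w e else 0) - (if e.2 = x then w e else 0))

/-- Admissible pair on `[0,T]`: `ρ ∈ W^{1,1}(0,T;M_m(X))`, `q ∈ L¹(0,T;M(E))`,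
with the continuity equation `ρ̇ + div q = 0`. -/
def IsAdmissible {X : Type*} [Fintype X] [DecidableEq X] (E : Finset (X × X)) (m T : ℝ)
    (ρ : ℝ → X → ℝ) (q : ℝ → (X × X) → ℝ) : Prop :=
  (∀ t ∈ Icc (0:ℝ) T, ρ t ∈ Mmass m) ∧
  (∀ t ∈ Icc (0:ℝ) T, q t ∈ MFlow E) ∧
  (∀ e ∈ E, IntervalIntegrable (fun t => q t e) volume 0 T) ∧
  (∀ x, ∀ t ∈ Icc (0:ℝ) T, ρ t x = ρ 0 x - ∫ s in (0:ℝ)..t, divFlow E (q s) x)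

/-- The set `A_{T,m}(q̄)`: admissible pairs whose time-averaged flow is `q̄`. -/
def InAdm {X : Type*} [Fintype X] [DecidableEq X] (E : Finset (X × X)) (m T : ℝ)
    (qbar : (X × X) → ℝ) (ρ : ℝ → X → ℝ) (q : ℝ → (X × X) → ℝ) : Prop :=
  IsAdmissible E m T ρ q ∧ ∀ e ∈ E, (∫ t in (0:ℝ)..T, q t e) = T * qbar e

/-- The cost `I_{[0,T]}(ρ,q)`. -/
noncomputable def costI {X : Type*} [Fintype X] [DecidableEq X] (E : Finset (X × X))
    (k : (X → ℝ) → (X × X) → ℝ) (T : ℝ) (ρ : ℝ → X → ℝ) (q : ℝ → (X × X) → ℝ) : ℝ≥0∞ :=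
  ∑ e ∈ E, ∫⁻ t in Ioc (0:ℝ) T, entS (q t e) (k (ρ t) e)

/-- `Ψ_{T,m}(q̄)`, with the convention `inf ∅ = ⊤`. -/
noncomputable def PsiT {X : Type*} [Fintype X] [DecidableEq X] (E : Finset (X × X))
    (k : (X → ℝ) → (X × X) → ℝ) (m T : ℝ) (qbar : (X × X) → ℝ) : ℝ≥0∞ :=
  ENNReal.ofReal (1 / T) *
    ⨅ (p : (ℝ → X → ℝ) × (ℝ → (X × X) → ℝ)) (_ : InAdm E m T qbar p.1 p.2),
      costI E k T p.1 p.2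

/-- `Ψ_{T,m}(q̄ | ρ*)`: same, restricted to pairs with `ρ(0) = ρ*`. -/
noncomputable def PsiTInit {X : Type*} [Fintype X] [DecidableEq X] (E : Finset (X × X))
    (k : (X → ℝ) → (X × X) → ℝ) (m T : ℝ) (qbar : (X × X) → ℝ) (ρstar : X → ℝ) : ℝ≥0∞ :=
  ENNReal.ofReal (1 / T) *
    ⨅ (p : (ℝ → X → ℝ) × (ℝ → (X × X) → ℝ))
      (_ : InAdm E m T qbar p.1 p.2 ∧ p.1 0 = ρstar),
      costI E k T p.1 p.2

/-- `Ψ_m(q̄) := lim_{T→∞} Ψ_{T,m}(q̄)`, realised as a `limsup`, which coincides with the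
limit whenever the limit exists. -/
noncomputable def PsiM {X : Type*} [Fintype X] [DecidableEq X] (E : Finset (X × X))
    (k : (X → ℝ) → (X × X) → ℝ) (m : ℝ) (qbar : (X × X) → ℝ) : ℝ≥0∞ :=
  Filter.limsup (fun T => PsiT E k m T qbar) Filter.atTop

/-- `Ψ⁺_m(q̄)`: the cost of the optimal constant strategy (only for divergence-free `q̄`). -/
noncomputable def PsiPlus {X : Type*} [Fintype X] [DecidableEq X] (E : Finset (X × X))
    (k : (X → ℝ) → (X × X) → ℝ) (m : ℝ) (qbar : (X × X) → ℝ) : ℝ≥0∞ :=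
  if ∀ x, divFlow E qbar x = 0 then
    ⨅ (ρ : X → ℝ) (_ : ρ ∈ Mmass m), ∑ e ∈ E, entS (qbar e) (k ρ e)
  else ⊤

/-- The standing assumptions on the jump rates `k`. -/
def RateAssumptions {X : Type*} [Fintype X] (E : Finset (X × X)) (m : ℝ)
    (k : (X → ℝ) → (X × X) → ℝ) : Prop :=
  (∀ ρ ∈ Mmass (X := X) m, ∀ e ∈ E, 0 ≤ k ρ e) ∧
  (∃ C : ℝ≥0, ∀ e ∈ E, LipschitzOnWith C (fun ρ => k ρ e) (Mmass m)) ∧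
  (∀ e ∈ E, ∀ ρ σ : X → ℝ, ρ ∈ Mmass m → σ ∈ Mmass m → ρ ≤ σ → k ρ e ≤ k σ e) ∧
  (∀ e ∈ E, ∀ ε > 0, ∃ δ > 0, ∀ ρ ∈ Mmass (X := X) m, ρ e.1 < δ → k ρ e < ε) ∧
  (∃ φ : ℝ → ℝ, MonotoneOn φ (Icc 0 1) ∧ Set.BijOn φ (Icc 0 1) (Icc 0 1) ∧
    ∀ ρ ∈ Mmass (X := X) m, ∀ δ ∈ Icc (0:ℝ) 1, ∀ e ∈ E, φ δ * k ρ e ≤ k (δ • ρ) e)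

/-- `Ψ⁻_m(q̄)`: infimum over the convex hull of the range of the rates. -/
noncomputable def PsiMinus {X : Type*} [Fintype X] [DecidableEq X] (E : Finset (X × X))
    (k : (X → ℝ) → (X × X) → ℝ) (m : ℝ) (qbar : (X × X) → ℝ) : ℝ≥0∞ :=
  ⨅ (K : (X × X) → ℝ) (_ : K ∈ convexHull ℝ (k '' Mmass m)),
    ∑ e ∈ E, entS (qbar e) (K e)

/-- In a finite-dimensional space the convex hull of a compact set is compact. -/
theorem IsCompact.isCompact_convexHull_of_finiteDimensional {V : Type*} [NormedAddCommGroup V]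
    [NormedSpace ℝ V] [FiniteDimensional ℝ V] {s : Set V} (hs : IsCompact s) :
    IsCompact (convexHull ℝ s) := by
  let d := Module.finrank ℝ V
  let comb : (Fin (d + 1) → ℝ) × (Fin (d + 1) → V) → V := fun p => ∑ i, p.1 i • p.2 i
  have hcomb : Continuous comb := by fun_prop
  have hK : IsCompact (stdSimplex ℝ (Fin (d + 1)) ×ˢ Set.univ.pi fun _ : Fin (d + 1) => s) :=
    (isCompact_stdSimplex ℝ _).prod (isCompact_univ_pi fun _ => hs)
  convert hK.image hcomb using 1
  ext x
  constructor
  · intro hx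
    obtain ⟨ι, _, z, w, hz, hind, hw, hw1, rfl⟩ := eq_pos_convex_span_of_mem_convexHull hx
    have hne : Nonempty ι := by
      by_contra h
      rw [not_nonempty_iff] at h
      simp at hw1
    obtain ⟨i₀⟩ := hne
    have hcard : Fintype.card ι ≤ Fintype.card (Fin (d + 1)) := by
      rw [Fintype.card_fin]
      refine hind.card_le_finrank_succ.trans ?_
      gcongr
      exact Submodule.finrank_le _
    obtain ⟨f⟩ := Function.Embedding.nonempty_of_card_le hcard
    refine ⟨(Function.extend f w 0, Function.extend f z fun _ => z i₀), ⟨⟨fun j => ?_, ?_⟩, ?_⟩, ?_⟩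
    · by_cases hj : ∃ i, f i = j
      · obtain ⟨i, rfl⟩ := hj
        simpa [f.injective.extend_apply] using (hw i).le
      · simp [Function.extend_apply' _ _ _ hj]
    · rw [← hw1]
      symm
      refine Fintype.sum_of_injective f f.injective _ _ (fun j hj => ?_) fun i => ?_
      · simp [Function.extend_apply' w (0 : Fin (d + 1) → ℝ) j hj]
      · simp [f.injective.extend_apply]
    · intro j _
      by_cases hj : ∃ i, f i = j
      · obtain ⟨i, rfl⟩ := hj
        simpa [f.injective.extend_apply] using hz ⟨i, rfl⟩
      · simpa [Function.extend_apply' _ _ _ hj] using hz ⟨i₀, rfl⟩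
    · symm
      refine Fintype.sum_of_injective f f.injective _ _ (fun j hj => ?_) fun i => ?_
      · simp [Function.extend_apply' w (0 : Fin (d + 1) → ℝ) j hj]
      · simp [f.injective.extend_apply]
  · rintro ⟨⟨w, z⟩, ⟨hw, hz⟩, rfl⟩
    exact (convex_convexHull ℝ s).sum_mem (fun i _ => hw.1 i) hw.2
      fun i _ => subset_convexHull ℝ s (hz i (Set.mem_univ i))

theorem isCompact_Mmass {X : Type*} [Fintype X] (m : ℝ) : IsCompact (Mmass (X := X) m) := by
  refine (isCompact_Icc (a := (0 : X → ℝ)) (b := fun _ => m)).of_isClosed_subset ?_ ?_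
  · exact (isClosed_le (f := fun _ => (0 : X → ℝ)) continuous_const continuous_id).inter
      (isClosed_eq (by fun_prop : Continuous fun ρ : X → ℝ => ∑ x, ρ x) continuous_const)
  · rintro ρ ⟨h0, h1⟩
    exact ⟨h0, fun x => h1 ▸ Finset.single_le_sum (fun y _ => h0 y) (Finset.mem_univ x)⟩

theorem ofReal_integral_le_lintegral_ofReal {α : Type*} [MeasurableSpace α] {μ : Measure α}
    {f : α → ℝ} (hf : Integrable f μ) :
    ENNReal.ofReal (∫ x, f x ∂μ) ≤ ∫⁻ x, ENNReal.ofReal (f x) ∂μ := by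
  have h : ∫ x, f x ∂μ ≤ ∫ x, max (f x) 0 ∂μ :=
    integral_mono hf hf.pos_part fun x => le_max_left _ _
  refine (ENNReal.ofReal_le_ofReal h).trans ?_
  rw [ofReal_integral_eq_lintegral_ofReal hf.pos_part (ae_of_all _ fun x => le_max_right _ _)]
  exact lintegral_mono fun x => by simp [ENNReal.ofReal_max]

/-- Fenchel–Young inequality for the entropy function. -/
theorem ofReal_dual_le_entS {a b : ℝ} (hb : 0 ≤ b) (l : ℝ) :
    ENNReal.ofReal (l * a - b * (Real.exp l - 1)) ≤ entS a b := by
  unfold entS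
  split_ifs with h1 h2
  · obtain ⟨ha, hb⟩ := h1
    apply ENNReal.ofReal_le_ofReal
    have h := Real.add_one_le_exp (l - Real.log (a / b))
    rw [Real.exp_sub, Real.exp_log (div_pos ha hb)] at h
    have h' := mul_le_mul_of_nonneg_left h ha.le
    have : a * (Real.exp l / (a / b)) = b * Real.exp l := by field_simp
    nlinarith
  · apply ENNReal.ofReal_le_ofReal
    rw [h2.1]
    nlinarith [mul_nonneg hb (Real.exp_pos l).le]
  · exact le_top

/-- The dual formula bounds the entropy function from above. -/
theorem entS_le_of_forall_dual_le {a b : ℝ} (ha : 0 ≤ a) (hb : 0 ≤ b) {C : ℝ≥0∞}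
    (h : ∀ l : ℝ, ENNReal.ofReal (l * a - b * (Real.exp l - 1)) ≤ C) : entS a b ≤ C := by
  unfold entS
  split_ifs with h1 h2
  · obtain ⟨ha, hb⟩ := h1
    convert h (Real.log (a / b)) using 2
    rw [Real.exp_log (div_pos ha hb)]
    field_simp
    ring
  · have hlim : Tendsto (fun l : ℝ => ENNReal.ofReal (l * a - b * (Real.exp l - 1))) atBot
        (nhds (ENNReal.ofReal b)) := by
      apply ENNReal.tendsto_ofReal
      have := (Real.tendsto_exp_atBot.sub_const 1).const_mul (-b)
      simp only [h2.1]
      convert this using 2 <;> ring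
    exact le_of_tendsto' hlim h
  · have hb0 : b = 0 := by
      by_contra hne
      have hb' := lt_of_le_of_ne hb (Ne.symm hne)
      exact h2 ⟨le_antisymm (not_lt.1 fun h => h1 ⟨h, hb'⟩) ha, hb⟩
    have ha' : 0 < a := lt_of_le_of_ne ha fun h => h2 ⟨h.symm, hb⟩
    have hlim : Tendsto (fun l : ℝ => ENNReal.ofReal (l * a - b * (Real.exp l - 1))) atTop
        (nhds ⊤) := by
      apply ENNReal.tendsto_ofReal_atTop.comp
      simpa [hb0] using tendsto_id.atTop_mul_const ha'
    exact le_of_tendsto' hlim h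

/-- Jensen's inequality for the entropy function and the normalised Lebesgue measure on `(0,T]`. -/
theorem entS_average_le {T : ℝ} (hT : 0 < T) {f g : ℝ → ℝ}
    (hf : IntervalIntegrable f volume 0 T) (hg : IntervalIntegrable g volume 0 T)
    (hf0 : ∀ t ∈ Icc 0 T, 0 ≤ f t) (hg0 : ∀ t ∈ Icc 0 T, 0 ≤ g t) :
    entS ((1 / T) * ∫ t in (0 : ℝ)..T, f t) ((1 / T) * ∫ t in (0 : ℝ)..T, g t) ≤
      ENNReal.ofReal (1 / T) * ∫⁻ t in Ioc (0 : ℝ) T, entS (f t) (g t) := by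
  have hT' : 0 ≤ 1 / T := by positivity
  refine entS_le_of_forall_dual_le
    (mul_nonneg hT' (intervalIntegral.integral_nonneg hT.le hf0))
    (mul_nonneg hT' (intervalIntegral.integral_nonneg hT.le hg0)) fun l => ?_
  have hint : IntervalIntegrable (fun t => l * f t - g t * (Real.exp l - 1)) volume 0 T :=
    (hf.const_mul l).sub (hg.mul_const _)
  have heq : l * ((1 / T) * ∫ t in (0 : ℝ)..T, f t) -
      ((1 / T) * ∫ t in (0 : ℝ)..T, g t) * (Real.exp l - 1) =
      (1 / T) * ∫ t in (0 : ℝ)..T, (l * f t - g t * (Real.exp l - 1)) := by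
    rw [intervalIntegral.integral_sub (hf.const_mul l) (hg.mul_const _),
      intervalIntegral.integral_const_mul, intervalIntegral.integral_mul_const]
    ring
  rw [heq, ENNReal.ofReal_mul hT', intervalIntegral.integral_of_le hT.le]
  gcongr
  refine (ofReal_integral_le_lintegral_ofReal
    ((intervalIntegrable_iff_integrableOn_Ioc_of_le hT.le).1 hint)).trans ?_
  refine setLIntegral_mono_ae' measurableSet_Ioc (ae_of_all _ fun t ht => ?_)
  exact ofReal_dual_le_entS (hg0 t (Ioc_subset_Icc_self ht)) l

section Admissible

variable {X : Type*} [Fintype X] [DecidableEq X] {E : Finset (X × X)} {m T : ℝ}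
  {ρ : ℝ → X → ℝ} {q : ℝ → (X × X) → ℝ}

theorem IsAdmissible.continuousOn (hT : 0 ≤ T) (h : IsAdmissible E m T ρ q) :
    ContinuousOn ρ (Icc 0 T) := by
  refine continuousOn_pi.2 fun x => ?_
  have hint : IntervalIntegrable (fun s => divFlow E (q s) x) volume 0 T := by
    unfold divFlow
    rw [intervalIntegrable_iff]
    refine integrable_finsetSum E fun e he => ?_
    rw [← IntegrableOn, ← intervalIntegrable_iff]
    refine IntervalIntegrable.sub ?_ ?_ <;> split_ifs <;> simp [h.2.2.1 e he]
  have hc := intervalIntegral.continuousOn_primitive_interval' hint left_mem_uIcc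
  rw [uIcc_of_le hT] at hc
  exact (continuousOn_const.sub hc).congr fun t ht => h.2.2.2 x t ht

theorem IsAdmissible.continuousOn_rate (hT : 0 ≤ T) (h : IsAdmissible E m T ρ q)
    {k : (X → ℝ) → (X × X) → ℝ} {e : X × X} (hk : Continuous fun ρ : X → ℝ => k ρ e) :
    ContinuousOn (fun t => k (ρ t) e) (Icc 0 T) :=
  hk.comp_continuousOn (h.continuousOn hT)

theorem InAdm.sum_entS_average_le_costI (hT : 0 < T) {qbar : (X × X) → ℝ}
    (h : InAdm E m T qbar ρ q) {k : (X → ℝ) → (X × X) → ℝ}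
    (hknn : ∀ ρ ∈ Mmass (X := X) m, ∀ e ∈ E, 0 ≤ k ρ e)
    (hkc : ∀ e ∈ E, Continuous fun ρ : X → ℝ => k ρ e) :
    (∑ e ∈ E, entS (qbar e) ((1 / T) * ∫ t in (0 : ℝ)..T, k (ρ t) e)) ≤
      ENNReal.ofReal (1 / T) * costI E k T ρ q := by
  rw [costI, Finset.mul_sum]
  refine Finset.sum_le_sum fun e he => ?_
  have hq : qbar e = (1 / T) * ∫ t in (0 : ℝ)..T, q t e := by
    rw [h.2 e he]
    field_simp
  rw [hq]
  refine entS_average_le hT (h.1.2.2.1 e he) ?_ (fun t ht => h.1.2.1 t ht e he)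
    fun t ht => hknn _ (h.1.1 t ht) e he
  exact ContinuousOn.intervalIntegrable_of_Icc hT.le (h.1.continuousOn_rate hT.le (hkc e he))

/-- On the edge set, the time average of the rates agrees with a point of the convex hull of the
range of the rates. -/
theorem IsAdmissible.exists_mem_convexHull_average (hT : 0 < T) (h : IsAdmissible E m T ρ q)
    {k : (X → ℝ) → (X × X) → ℝ} (hkc : ∀ e ∈ E, Continuous fun ρ : X → ℝ => k ρ e) :
    ∃ K ∈ convexHull ℝ (k '' Mmass m),
      ∀ e ∈ E, K e = (1 / T) * ∫ t in (0 : ℝ)..T, k (ρ t) e := by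
  let L : ((X × X) → ℝ) →ₗ[ℝ] (E → ℝ) := LinearMap.funLeft ℝ ℝ Subtype.val
  have hL : Continuous fun ρ : X → ℝ => L (k ρ) := continuous_pi fun e => hkc e e.2
  have hcomp : IsCompact (convexHull ℝ ((fun ρ => L (k ρ)) '' Mmass m)) :=
    ((isCompact_Mmass m).image hL).isCompact_convexHull_of_finiteDimensional
  have hcont : ContinuousOn (fun t => L (k (ρ t))) (Icc 0 T) :=
    hL.comp_continuousOn (h.continuousOn hT.le)
  have hint : IntegrableOn (fun t => L (k (ρ t))) (Ioc 0 T) :=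
    hcont.integrableOn_Icc.mono_set Ioc_subset_Icc_self
  have hmem : (⨍ t in Ioc 0 T, L (k (ρ t))) ∈ convexHull ℝ ((fun ρ => L (k ρ)) '' Mmass m) := by
    refine (convex_convexHull ℝ _).set_average_mem hcomp.isClosed (by simp [hT]) (by simp) ?_ hint
    refine (ae_restrict_iff' measurableSet_Ioc).2 (ae_of_all _ fun t ht => ?_)
    exact subset_convexHull ℝ _ ⟨ρ t, h.1 t (Ioc_subset_Icc_self ht), rfl⟩
  rw [← Set.image_image L k, ← LinearMap.image_convexHull] at hmem
  obtain ⟨K, hK, hKeq⟩ := hmem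
  refine ⟨K, hK, fun e he => ?_⟩
  have := congrFun hKeq ⟨e, he⟩
  rw [setAverage_eq, Pi.smul_apply, eval_integral fun e => Integrable.eval hint e] at this
  rw [intervalIntegral.integral_of_le hT.le]
  simpa [L, hT.le] using this

theorem InAdm.psiMinus_le_sum_entS_average (hT : 0 < T) {qbar : (X × X) → ℝ}
    (h : InAdm E m T qbar ρ q) {k : (X → ℝ) → (X × X) → ℝ}
    (hkc : ∀ e ∈ E, Continuous fun ρ : X → ℝ => k ρ e) :
    PsiMinus E k m qbar ≤
      ∑ e ∈ E, entS (qbar e) ((1 / T) * ∫ t in (0 : ℝ)..T, k (ρ t) e) := by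
  obtain ⟨K, hK, hKe⟩ := h.1.exists_mem_convexHull_average hT hkc
  refine (iInf₂_le K hK).trans (Finset.sum_le_sum fun e he => ?_)
  rw [hKe e he]

theorem psiMinus_le_psiT (hT : 0 < T) {qbar : (X × X) → ℝ} {k : (X → ℝ) → (X × X) → ℝ}
    (hknn : ∀ ρ ∈ Mmass (X := X) m, ∀ e ∈ E, 0 ≤ k ρ e)
    (hkc : ∀ e ∈ E, Continuous fun ρ : X → ℝ => k ρ e) :
    PsiMinus E k m qbar ≤ PsiT E k m T qbar := by
  have h0 : ENNReal.ofReal (1 / T) ≠ 0 := by simpa using hT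
  rw [PsiT, ENNReal.mul_iInf_of_ne h0 ENNReal.ofReal_ne_top]
  refine le_iInf fun p => ?_
  rw [ENNReal.mul_iInf_of_ne h0 ENNReal.ofReal_ne_top]
  exact le_iInf fun hp => (hp.psiMinus_le_sum_entS_average hT hkc).trans
    (hp.sum_entS_average_le_costI hT hknn hkc)

/-- The constant strategy bounds `Ψ_{T,m}` from above. -/
theorem psiT_le_sum_entS (hT : 0 < T) {qbar : (X × X) → ℝ} (hqbar : qbar ∈ MFlow E)
    (hdiv : ∀ x, divFlow E qbar x = 0) (k : (X → ℝ) → (X × X) → ℝ) {σ : X → ℝ}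
    (hσ : σ ∈ Mmass m) : PsiT E k m T qbar ≤ ∑ e ∈ E, entS (qbar e) (k σ e) := by
  have hadm : InAdm E m T qbar (fun _ => σ) fun _ => qbar :=
    ⟨⟨fun _ _ => hσ, fun _ _ => hqbar, fun _ _ => by simp, fun x t _ => by simp [hdiv]⟩,
      fun e _ => by simp⟩
  have hcost : ENNReal.ofReal (1 / T) * costI E k T (fun _ => σ) (fun _ => qbar) =
      ∑ e ∈ E, entS (qbar e) (k σ e) := by
    simp only [costI, setLIntegral_const, Real.volume_Ioc, sub_zero]
    rw [← Finset.sum_mul, mul_comm, mul_assoc, ← ENNReal.ofReal_mul hT.le,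
      mul_one_div_cancel hT.ne', ENNReal.ofReal_one, mul_one]
  rw [← hcost, PsiT]
  gcongr
  exact iInf₂_le (f := fun (p : (ℝ → X → ℝ) × (ℝ → (X × X) → ℝ))
    (_ : InAdm E m T qbar p.1 p.2) => costI E k T p.1 p.2) (_, _) hadm

end Admissible

/-- lower bound in Proposition "Ψ bounds", by Jensen's inequality:
for divergence-free `q̄`, every `T > 0` and `(ρ,q) ∈ A_{T,m}(q̄)`,
`(1/T) I_{[0,T]}(ρ,q) ≥ Σ_e s(q̄_e | (1/T)∫₀ᵀ k_e(ρ(t)) dt) ≥ Ψ⁻_m(q̄)`; consequently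
`Ψ⁻_m(q̄) ≤ Ψ_m(q̄) ≤ Ψ⁺_m(q̄)`. -/
theorem psiMinus_le_psi_le_psiPlus {X : Type*} [Fintype X] [DecidableEq X] [Nonempty X]
    (E : Finset (X × X)) (hE : ∀ x : X, (x, x) ∉ E)
    (m : ℝ) (hm : 0 < m)
    (k : (X → ℝ) → (X × X) → ℝ)
    (hknn : ∀ ρ ∈ Mmass (X := X) m, ∀ e ∈ E, 0 ≤ k ρ e)
    (hkc : ∀ e ∈ E, Continuous fun ρ : X → ℝ => k ρ e)
    (qbar : (X × X) → ℝ) (hqbar : qbar ∈ MFlow E)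
    (hdiv : ∀ x, divFlow E qbar x = 0) :
    (∀ T > (0:ℝ), ∀ ρ q, InAdm E m T qbar ρ q →
      (∑ e ∈ E, entS (qbar e) ((1 / T) * ∫ t in (0:ℝ)..T, k (ρ t) e)) ≤
          ENNReal.ofReal (1 / T) * costI E k T ρ q ∧
      PsiMinus E k m qbar ≤
        ∑ e ∈ E, entS (qbar e) ((1 / T) * ∫ t in (0:ℝ)..T, k (ρ t) e)) ∧
    PsiMinus E k m qbar ≤ PsiM E k m qbar ∧
    PsiM E k m qbar ≤ PsiPlus E k m qbar := by
  refine ⟨fun T hT ρ q h => ⟨h.sum_entS_average_le_costI hT hknn hkc,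
    h.psiMinus_le_sum_entS_average hT hkc⟩, ?_, ?_⟩
  · refine le_limsup_of_frequently_le (Eventually.frequently ?_)
    filter_upwards [eventually_gt_atTop 0] with T hT
    exact psiMinus_le_psiT hT hknn hkc
  · rw [PsiPlus, if_pos hdiv]
    refine le_iInf₂ fun σ hσ => limsup_le_of_le ?_ ?_
    · isBoundedDefault
    · filter_upwards [eventually_gt_atTop 0] with T hT
      exact psiT_le_sum_entS hT hqbar hdiv k hσ
end

section
/- If the map (ρ,q) ↦ Σ_{(x,y)∈E} s(q_{x,y} | k_{x,y}(ρ)) is jointly convex on M_m(X) × M(E), then for every divergence-free q̄ ∈ M(E) and every T > 0 and (ρ,q) ∈ A_{T,m}(q̄) one has (1/T) I_{[0,T]}(ρ,q) ≥ Ψ⁺_m(q̄); consequently Ψ_m(q̄) = Ψ⁺_m(q̄) and there are no dynamical phase transitions. -/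
open MeasureTheory Filter Set
open scoped Classical ENNReal NNReal

/-- Jensen's inequality for lower semicontinuous convex functions with values in `[0,∞]`. -/
theorem jensen_lintegral_of_lowerSemicontinuous {Ω V : Type*} [MeasurableSpace Ω]
    [NormedAddCommGroup V] [NormedSpace ℝ V] [CompleteSpace V] [MeasurableSpace V] [BorelSpace V]
    {μ : Measure Ω} [IsProbabilityMeasure μ] {G : V → ℝ≥0∞} {s : Set V} {f : Ω → V}
    (hG : LowerSemicontinuous G) (hs : IsClosed s) (hsc : Convex ℝ s)
    (hGc : ∀ x ∈ s, ∀ y ∈ s, ∀ a b : ℝ, 0 ≤ a → 0 ≤ b → a + b = 1 →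
      G (a • x + b • y) ≤ ENNReal.ofReal a * G x + ENNReal.ofReal b * G y)
    (hf : Integrable f μ) (hfs : ∀ᵐ t ∂μ, f t ∈ s) :
    G (∫ t, f t ∂μ) ≤ ∫⁻ t, G (f t) ∂μ := by
  by_cases htop : ∫⁻ t, G (f t) ∂μ = ⊤
  · simp [htop]
  have hm : AEMeasurable (fun t => G (f t)) μ :=
    hG.measurable.comp_aemeasurable hf.1.aemeasurable
  have hlt : ∀ᵐ t ∂μ, G (f t) < ⊤ := ae_lt_top' hm htop
  have hint : Integrable (fun t => (G (f t)).toReal) μ :=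
    integrable_toReal_of_lintegral_ne_top hm htop
  have hpair : Integrable (fun t => (f t, (G (f t)).toReal)) μ := hf.prodMk hint
  set S : Set (V × ℝ) := {p | p.1 ∈ s ∧ 0 ≤ p.2 ∧ G p.1 ≤ ENNReal.ofReal p.2} with hS
  have hclosed : IsClosed S := by
    refine (hs.preimage continuous_fst).inter ((isClosed_Ici.preimage continuous_snd).inter ?_)
    exact hG.isClosed_epigraph.preimage
      (continuous_fst.prodMk (ENNReal.continuous_ofReal.comp continuous_snd))
  have hconv : Convex ℝ S := by
    rintro ⟨x, r⟩ ⟨hx, hr, hxr⟩ ⟨y, u⟩ ⟨hy, hu, hyu⟩ a b ha hb hab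
    simp only at hx hr hxr hy hu hyu
    refine ⟨hsc hx hy ha hb hab, ?_, ?_⟩
    · simp only [Prod.smul_mk, Prod.mk_add_mk, smul_eq_mul]; positivity
    · simp only [Prod.smul_mk, Prod.mk_add_mk, smul_eq_mul]
      refine (hGc x hx y hy a b ha hb hab).trans ?_
      rw [ENNReal.ofReal_add (by positivity) (by positivity), ENNReal.ofReal_mul ha,
        ENNReal.ofReal_mul hb]
      gcongr
  have hmem := hconv.integral_mem hclosed (f := fun t => (f t, (G (f t)).toReal)) (μ := μ) (by
    filter_upwards [hfs, hlt] with t ht ht'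
    exact ⟨ht, ENNReal.toReal_nonneg, (ENNReal.ofReal_toReal ht'.ne).ge⟩) hpair
  have h := hmem.2.2
  rw [fst_integral hpair, snd_integral hpair, integral_toReal hm hlt,
    ENNReal.ofReal_toReal htop] at h
  exact h

/-- The entropy function is a supremum of functions that are positive parts of linear ones. -/
theorem entS_eq_iSup {a b : ℝ} (ha : 0 ≤ a) (hb : 0 ≤ b) :
    entS a b = ⨆ l : ℝ, ENNReal.ofReal (l * a - (Real.exp l - 1) * b) := by
  rcases ha.eq_or_lt with rfl | ha
  · simp only [entS, lt_self_iff_false, false_and, if_false, hb, and_self, if_true]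
    apply le_antisymm
    · have h : Tendsto (fun l : ℝ => ENNReal.ofReal (l * 0 - (Real.exp l - 1) * b)) atBot
          (nhds (ENNReal.ofReal (0 - (0 - 1) * b))) := by
        simp only [mul_zero]
        exact ENNReal.tendsto_ofReal
          (((Real.tendsto_exp_atBot.sub_const 1).mul_const b).const_sub 0)
      rw [show 0 - (0 - 1) * b = b by ring] at h
      exact le_of_tendsto' h fun l => le_iSup
        (fun l : ℝ => ENNReal.ofReal (l * 0 - (Real.exp l - 1) * b)) l
    · refine iSup_le fun l => ENNReal.ofReal_le_ofReal ?_
      nlinarith [Real.exp_pos l]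
  rcases hb.eq_or_lt with rfl | hb
  · have : entS a 0 = ⊤ := by simp [entS, ha.ne']
    rw [this, eq_comm, iSup_eq_top]
    intro c hc
    refine ⟨(c.toReal + 1) / a, ?_⟩
    rw [mul_zero, sub_zero, div_mul_cancel₀ _ ha.ne', ENNReal.lt_ofReal_iff_toReal_lt hc.ne]
    linarith
  · rw [entS, if_pos ⟨ha, hb⟩]
    apply le_antisymm
    · refine le_iSup_of_le (Real.log (a / b)) (ENNReal.ofReal_le_ofReal (le_of_eq ?_))
      rw [Real.exp_log (by positivity)]
      field_simp
      ring
    · refine iSup_le fun l => ENNReal.ofReal_le_ofReal ?_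
      have h := Real.add_one_le_exp (l - Real.log (a / b))
      rw [Real.exp_sub, Real.exp_log (by positivity)] at h
      have h2 := mul_le_mul_of_nonneg_left h ha.le
      have h3 : a * (Real.exp l / (a / b)) = Real.exp l * b := by field_simp
      rw [h3] at h2
      nlinarith

theorem lowerSemicontinuous_iSup_entropy {V : Type*} [TopologicalSpace V] {f g : V → ℝ}
    (hf : Continuous f) (hg : Continuous g) :
    LowerSemicontinuous fun v =>
      ⨆ l : ℝ, ENNReal.ofReal (l * f v - (Real.exp l - 1) * g v) :=
  lowerSemicontinuous_iSup fun l => Continuous.lowerSemicontinuous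
    (ENNReal.continuous_ofReal.comp (by fun_prop))

theorem convex_Mmass {X : Type*} [Fintype X] (m : ℝ) : Convex ℝ (Mmass (X := X) m) := by
  rintro x ⟨hx, hx'⟩ y ⟨hy, hy'⟩ a b ha hb hab
  refine ⟨fun i => ?_, ?_⟩
  · have := hx i
    have := hy i
    simp only [Pi.add_apply, Pi.smul_apply, smul_eq_mul]
    positivity
  · simp only [Pi.add_apply, Pi.smul_apply, smul_eq_mul, Finset.sum_add_distrib,
      ← Finset.mul_sum, hx', hy', ← add_mul, hab, one_mul]

theorem isClosed_Mmass {X : Type*} [Fintype X] (m : ℝ) : IsClosed (Mmass (X := X) m) := by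
  refine IsClosed.inter (s₁ := {ρ : X → ℝ | ∀ x, 0 ≤ ρ x}) ?_
    (isClosed_eq (by fun_prop) continuous_const)
  simp only [ofPred_forall]
  exact isClosed_iInter fun x => isClosed_le continuous_const (continuous_apply x)

theorem convex_MFlow {X : Type*} (E : Finset (X × X)) : Convex ℝ (MFlow E) := by
  intro x hx y hy a b ha hb _ e he
  have := hx e he
  have := hy e he
  simp only [Pi.add_apply, Pi.smul_apply, smul_eq_mul]
  positivity

theorem isClosed_MFlow {X : Type*} (E : Finset (X × X)) : IsClosed (MFlow E) := by
  simp only [MFlow, ofPred_forall]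
  exact isClosed_iInter fun e => isClosed_iInter fun _ =>
    isClosed_le continuous_const (continuous_apply e)

/-- The density of an admissible pair is continuous in time. -/
theorem IsAdmissible.continuousOn_density {X : Type*} [Fintype X] [DecidableEq X]
    {E : Finset (X × X)} {m T : ℝ} {ρ : ℝ → X → ℝ} {q : ℝ → (X × X) → ℝ} (hT : 0 < T)
    (h : IsAdmissible E m T ρ q) (x : X) : ContinuousOn (fun t => ρ t x) (Icc 0 T) := by
  have hdiv : IntegrableOn (fun s => divFlow E (q s) x) (Icc 0 T) := by
    refine integrable_finsetSum _ fun e he => ?_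
    have hq : IntegrableOn (fun t => q t e) (Icc 0 T) :=
      (intervalIntegrable_iff_integrableOn_Icc_of_le hT.le).1 (h.2.2.1 e he)
    refine Integrable.sub ?_ ?_ <;> split_ifs <;> first | exact hq | exact integrable_zero _ _ _
  have hc := intervalIntegral.continuousOn_primitive_interval (a := 0) (b := T)
    (f := fun s => divFlow E (q s) x) (by rwa [uIcc_of_le hT.le])
  rw [uIcc_of_le hT.le] at hc
  exact (continuousOn_const.sub hc).congr fun t ht => h.2.2.2 x t ht

/-- A constant strategy along a divergence-free flow is admissible, whence an upper bound. -/
theorem PsiT_le_PsiPlus {X : Type*} [Fintype X] [DecidableEq X] (E : Finset (X × X))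
    (k : (X → ℝ) → (X × X) → ℝ) (m : ℝ) {T : ℝ} (hT : 0 < T) {qbar : (X × X) → ℝ}
    (hq : qbar ∈ MFlow E) (hdiv : ∀ x, divFlow E qbar x = 0) :
    PsiT E k m T qbar ≤ PsiPlus E k m qbar := by
  rw [PsiPlus, if_pos hdiv]
  refine le_iInf₂ fun ρ hρ => ?_
  have hadm : InAdm E m T qbar (fun _ => ρ) (fun _ => qbar) := by
    refine ⟨⟨fun _ _ => hρ, fun _ _ => hq, fun _ _ => intervalIntegrable_const, ?_⟩, ?_⟩
    · intro x t _
      simp [hdiv]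
    · intro e _
      simp
  calc PsiT E k m T qbar
      ≤ ENNReal.ofReal (1 / T) * costI E k T (fun _ => ρ) (fun _ => qbar) :=
        mul_le_mul_right (iInf₂_le (⟨fun _ => ρ, fun _ => qbar⟩ :
          (ℝ → X → ℝ) × (ℝ → (X × X) → ℝ)) hadm) _
    _ = ∑ e ∈ E, entS (qbar e) (k ρ e) := by
        simp only [costI, lintegral_const, Measure.restrict_apply_univ, Real.volume_Ioc, sub_zero,
          ← Finset.sum_mul]
        rw [mul_left_comm, ← ENNReal.ofReal_mul (by positivity), one_div_mul_cancel hT.ne',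
          ENNReal.ofReal_one, mul_one]

/-- Proposition "jointly convex": if the static cost
`(ρ,q) ↦ Σ_e s(q_e | k_e(ρ))` is jointly convex on `M_m(X) × M(E)`, then for every
divergence-free `q̄` every admissible pair has time-averaged cost at least `Ψ⁺_m(q̄)`;
consequently `Ψ_m(q̄) = Ψ⁺_m(q̄)` and there are no dynamical phase transitions. -/
theorem no_DPT_of_jointly_convex {X : Type*} [Fintype X] [DecidableEq X] [Nonempty X]
    (E : Finset (X × X)) (hE : ∀ x : X, (x, x) ∉ E)
    (m : ℝ) (hm : 0 < m)
    (k : (X → ℝ) → (X × X) → ℝ)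
    (hknn : ∀ ρ ∈ Mmass (X := X) m, ∀ e ∈ E, 0 ≤ k ρ e)
    (hkc : ∀ e ∈ E, Continuous fun ρ : X → ℝ => k ρ e)
    (hjc : ∀ ρ₁ ∈ Mmass (X := X) m, ∀ ρ₂ ∈ Mmass (X := X) m,
      ∀ q₁ ∈ MFlow E, ∀ q₂ ∈ MFlow E, ∀ a b : ℝ, 0 ≤ a → 0 ≤ b → a + b = 1 →
        (∑ e ∈ E, entS (a * q₁ e + b * q₂ e) (k (fun x => a * ρ₁ x + b * ρ₂ x) e)) ≤
          ENNReal.ofReal a * ∑ e ∈ E, entS (q₁ e) (k ρ₁ e) +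
            ENNReal.ofReal b * ∑ e ∈ E, entS (q₂ e) (k ρ₂ e)) :
    ∀ qbar ∈ MFlow E, (∀ x, divFlow E qbar x = 0) →
      (∀ T > (0:ℝ), ∀ ρ q, InAdm E m T qbar ρ q →
        PsiPlus E k m qbar ≤ ENNReal.ofReal (1 / T) * costI E k T ρ q) ∧
      PsiM E k m qbar = PsiPlus E k m qbar := by
  intro qbar hqbar hdiv
  have key : ∀ T > (0:ℝ), ∀ ρ q, InAdm E m T qbar ρ q →
      PsiPlus E k m qbar ≤ ENNReal.ofReal (1 / T) * costI E k T ρ q := by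
    intro T hT ρ q h
    let G : (X → ℝ) × ((X × X) → ℝ) → ℝ≥0∞ := fun p =>
      ∑ e ∈ E, ⨆ l : ℝ, ENNReal.ofReal (l * p.2 e - (Real.exp l - 1) * k p.1 e)
    have hlsc : ∀ e ∈ E, LowerSemicontinuous fun p : (X → ℝ) × ((X × X) → ℝ) =>
        ⨆ l : ℝ, ENNReal.ofReal (l * p.2 e - (Real.exp l - 1) * k p.1 e) := fun e he =>
      lowerSemicontinuous_iSup_entropy ((continuous_apply e).comp continuous_snd)
        ((hkc e he).comp continuous_fst)
    have hG : LowerSemicontinuous G := lowerSemicontinuous_sum hlsc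
    let s : Set ((X → ℝ) × ((X × X) → ℝ)) := Mmass m ×ˢ MFlow E
    have hGs : ∀ p ∈ s, G p = ∑ e ∈ E, entS (p.2 e) (k p.1 e) := fun p hp =>
      Finset.sum_congr rfl fun e he =>
        (entS_eq_iSup (hp.2 e he) (hknn p.1 hp.1 e he)).symm
    have hsc : Convex ℝ s := (convex_Mmass m).prod (convex_MFlow E)
    let μ : Measure ℝ := ENNReal.ofReal (1 / T) • volume.restrict (Ioc 0 T)
    have hμ : IsProbabilityMeasure μ := ⟨by
      simp only [μ, Measure.smul_apply, Measure.restrict_apply_univ, Real.volume_Ioc, sub_zero,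
        smul_eq_mul]
      rw [← ENNReal.ofReal_mul (by positivity), one_div_mul_cancel hT.ne', ENNReal.ofReal_one]⟩
    have hae : ∀ᵐ t ∂μ, t ∈ Icc 0 T :=
      Measure.ae_smul_measure ((ae_restrict_mem measurableSet_Ioc).mono
        fun t ht => Ioc_subset_Icc_self ht) _
    let f : ℝ → (X → ℝ) × ((X × X) → ℝ) := fun t => (ρ t, fun e => if e ∈ E then q t e else 0)
    have hf₁ : ∀ x, Integrable (fun t => ρ t x) μ := fun x =>
      (((h.1.continuousOn_density hT x).integrableOn_Icc).mono_set
        Ioc_subset_Icc_self).smul_measure ENNReal.ofReal_ne_top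
    have hf₂ : ∀ e, Integrable (fun t => if e ∈ E then q t e else 0) μ := fun e => by
      split_ifs with he
      · exact ((intervalIntegrable_iff_integrableOn_Ioc_of_le hT.le).1
          (h.1.2.2.1 e he)).smul_measure ENNReal.ofReal_ne_top
      · exact integrable_zero _ _ _
    have hf : Integrable f μ := (Integrable.of_eval hf₁).prodMk (Integrable.of_eval hf₂)
    have hfs : ∀ᵐ t ∂μ, f t ∈ s := by
      filter_upwards [hae] with t ht
      refine ⟨h.1.1 t ht, fun e he => ?_⟩
      simpa [f, he] using h.1.2.1 t ht e he
    have hjensen := jensen_lintegral_of_lowerSemicontinuous hG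
      ((isClosed_Mmass m).prod (isClosed_MFlow E)) hsc (by
        intro p hp p' hp' a b ha hb hab
        rw [hGs p hp, hGs p' hp', hGs _ (hsc hp hp' ha hb hab)]
        exact hjc p.1 hp.1 p'.1 hp'.1 p.2 hp.2 p'.2 hp'.2 a b ha hb hab) hf hfs
    have hmem : ∫ t, f t ∂μ ∈ s :=
      hsc.integral_mem ((isClosed_Mmass m).prod (isClosed_MFlow E)) hfs hf
    have hsnd : ∀ e ∈ E, (∫ t, f t ∂μ).2 e = qbar e := by
      intro e he
      rw [snd_integral hf, eval_integral hf₂ e]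
      simp only [he, if_true, μ, integral_smul_measure]
      rw [← intervalIntegral.integral_of_le hT.le, h.2 e he,
        ENNReal.toReal_ofReal (by positivity), smul_eq_mul]
      field_simp
    have hcost : ∫⁻ t, G (f t) ∂μ = ENNReal.ofReal (1 / T) * costI E k T ρ q := by
      refine (lintegral_finsetSum' E fun e he =>
        (hlsc e he).measurable.comp_aemeasurable hf.1.aemeasurable).trans ?_
      rw [costI, Finset.mul_sum]
      refine Finset.sum_congr rfl fun e he => ?_
      refine (lintegral_smul_measure _ _).trans (congrArg _ ?_)
      refine setLIntegral_congr_fun measurableSet_Ioc fun t ht => ?_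
      have ht' := Ioc_subset_Icc_self ht
      simp only [Function.comp_apply, f, he, if_true]
      exact (entS_eq_iSup (h.1.2.1 t ht' e he) (hknn _ (h.1.1 t ht') e he)).symm
    rw [PsiPlus, if_pos hdiv, ← hcost]
    refine (iInf₂_le _ hmem.1).trans (le_trans (le_of_eq ?_) hjensen)
    rw [hGs _ hmem]
    exact Finset.sum_congr rfl fun e he => by rw [hsnd e he]
  refine ⟨key, ?_⟩
  have hev : (fun T => PsiT E k m T qbar) =ᶠ[atTop] fun _ => PsiPlus E k m qbar := by
    filter_upwards [eventually_gt_atTop (0:ℝ)] with T hT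
    refine le_antisymm (PsiT_le_PsiPlus E k m hT hqbar hdiv) ?_
    have h0 : ENNReal.ofReal (1 / T) ≠ 0 := by simpa using hT
    rw [PsiT, ENNReal.mul_iInf_of_ne h0 ENNReal.ofReal_ne_top]
    refine le_iInf fun p => ?_
    rw [ENNReal.mul_iInf_of_ne h0 ENNReal.ofReal_ne_top]
    exact le_iInf fun hp => key T hT p.1 p.2 hp
  rw [PsiM, limsup_congr hev, limsup_const]
end

section
/- Let k : (0,∞) → (0,∞) be twice continuously differentiable. The function f(ρ,q) := q log(q / k(ρ)) − q + k(ρ) is jointly convex on (0,∞) × (0,∞) if and only if k''(ρ) = 0 for all ρ > 0, i.e. if and only if k is affine on (0,∞). -/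
/-- The tangent planes `(q, x) ↦ q log c + (1 - c) x` of the entropy function lie below it. -/
theorem entropy_tangent_le {q x c : ℝ} (hq : 0 < q) (hx : 0 < x) (hc : 0 < c) :
    q * Real.log c + (1 - c) * x ≤ q * Real.log (q / x) - q + x := by
  have h := Real.one_sub_inv_le_log_of_pos (show 0 < q / x / c by positivity)
  rw [Real.log_div (by positivity) hc.ne'] at h
  have h2 := mul_le_mul_of_nonneg_left h hq.le
  have h3 : q * (1 - (q / x / c)⁻¹) = q - c * x := by field_simp
  rw [h3] at h2
  linarith

theorem convexOn_entropy_of_affine {k : ℝ → ℝ} {a b : ℝ}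
    (hkpos : ∀ ρ > (0:ℝ), 0 < k ρ) (hk : ∀ ρ > (0:ℝ), k ρ = a * ρ + b) :
    ConvexOn ℝ (Set.Ioi (0:ℝ) ×ˢ Set.Ioi (0:ℝ))
      (fun p : ℝ × ℝ => p.2 * Real.log (p.2 / k p.1) - p.2 + k p.1) := by
  refine ⟨(convex_Ioi 0).prod (convex_Ioi 0), ?_⟩
  intro x hx y hy s t hs ht hst
  have hz : s • x + t • y ∈ Set.Ioi (0:ℝ) ×ˢ Set.Ioi (0:ℝ) :=
    ((convex_Ioi 0).prod (convex_Ioi 0)) hx hy hs ht hst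
  obtain ⟨hx1, hx2⟩ := hx
  obtain ⟨hy1, hy2⟩ := hy
  obtain ⟨hz1, hz2⟩ := hz
  simp only [Set.mem_Ioi, Prod.fst_add, Prod.snd_add, Prod.smul_fst, Prod.smul_snd,
    smul_eq_mul] at *
  have hkz := hkpos _ hz1
  have hmix : k (s * x.1 + t * y.1) = s * k x.1 + t * k y.1 := by
    rw [hk _ hz1, hk _ hx1, hk _ hy1]
    linear_combination (-b) * hst
  have hc : 0 < (s * x.2 + t * y.2) / k (s * x.1 + t * y.1) := div_pos hz2 hkz
  have hcz : (s * x.2 + t * y.2) / k (s * x.1 + t * y.1) * k (s * x.1 + t * y.1)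
      = s * x.2 + t * y.2 := div_mul_cancel₀ _ hkz.ne'
  have ex := mul_le_mul_of_nonneg_left (entropy_tangent_le hx2 (hkpos _ hx1) hc) hs
  have ey := mul_le_mul_of_nonneg_left (entropy_tangent_le hy2 (hkpos _ hy1) hc) ht
  generalize (s * x.2 + t * y.2) / k (s * x.1 + t * y.1) = c at *
  rw [hmix] at hcz ⊢
  linarith

/-- A convex entropy function satisfies the tangent inequality between two points of the
curve `q = c k(ρ)`. -/
theorem mul_tangent_nonneg_of_convexOn_entropy {k : ℝ → ℝ} {m x y c : ℝ}
    (hkpos : ∀ ρ > (0:ℝ), 0 < k ρ) (hd : HasDerivAt k m x)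
    (hconv : ConvexOn ℝ (Set.Ioi (0:ℝ) ×ˢ Set.Ioi (0:ℝ))
      (fun p : ℝ × ℝ => p.2 * Real.log (p.2 / k p.1) - p.2 + k p.1))
    (hx : 0 < x) (hy : 0 < y) (hc : 0 < c) :
    0 ≤ (1 - c) * (k y - k x - m * (y - x)) := by
  have hkx := hkpos x hx
  have hky := hkpos y hy
  have hg := hconv.comp_affineMap
    (AffineMap.lineMap (k := ℝ) ((x, c * k x) : ℝ × ℝ) (y, c * k y))
  set ρ : ℝ → ℝ := fun t => t * (y - x) + x with hρ
  set q : ℝ → ℝ := fun t => t * (c * k y - c * k x) + c * k x with hq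
  have hdρ : HasDerivAt ρ (y - x) 0 := by
    simpa [hρ] using ((hasDerivAt_id (0:ℝ)).mul_const (y - x)).add_const x
  have hdq : HasDerivAt q (c * k y - c * k x) 0 := by
    simpa [hq] using ((hasDerivAt_id (0:ℝ)).mul_const (c * k y - c * k x)).add_const (c * k x)
  have hρ0 : ρ 0 = x := by simp [hρ]
  have hq0 : q 0 = c * k x := by simp [hq]
  have hdk : HasDerivAt (fun t => k (ρ t)) (m * (y - x)) 0 :=
    HasDerivAt.comp (0:ℝ) (by rwa [hρ0]) hdρ
  have hdl := (hdq.fun_div hdk (by rw [hρ0]; exact hkx.ne')).log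
    (by rw [hρ0, hq0]; positivity)
  have hD := ((hdq.fun_mul hdl).fun_sub hdq).fun_add hdk
  have heq : ((fun p : ℝ × ℝ => p.2 * Real.log (p.2 / k p.1) - p.2 + k p.1) ∘
      (AffineMap.lineMap (k := ℝ) ((x, c * k x) : ℝ × ℝ) (y, c * k y))) =
      fun t => q t * Real.log (q t / k (ρ t)) - q t + k (ρ t) := by
    funext t
    simp [AffineMap.lineMap_apply, hρ, hq]
  rw [heq] at hg
  have h := hg.le_slope_of_hasDerivAt (x := 0) (y := 1)
    (by simp [hx, mul_pos hc hkx]) (by simp [hy, mul_pos hc hky]) one_pos hD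
  have hρ1 : ρ 1 = y := by simp [hρ]
  have hq1 : q 1 = c * k y := by simp [hq]
  simp only [slope_def_field, hρ0, hq0, hρ1, hq1, mul_div_cancel_right₀ _ hkx.ne',
    mul_div_cancel_right₀ _ hky.ne', sub_zero, div_one] at h
  have hs : c * k x * ((((c * k y - c * k x) * k x - c * k x * (m * (y - x))) / k x ^ 2) / c)
      = c * k y - c * k x - c * (m * (y - x)) := by
    field_simp
  rw [hs] at h
  linarith

theorem affine_of_convexOn_entropy {k : ℝ → ℝ} {m : ℝ}
    (hkpos : ∀ ρ > (0:ℝ), 0 < k ρ) (hd : HasDerivAt k m 1)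
    (hconv : ConvexOn ℝ (Set.Ioi (0:ℝ) ×ˢ Set.Ioi (0:ℝ))
      (fun p : ℝ × ℝ => p.2 * Real.log (p.2 / k p.1) - p.2 + k p.1)) :
    ∃ a b : ℝ, ∀ ρ > (0:ℝ), k ρ = a * ρ + b := by
  refine ⟨m, k 1 - m, fun ρ hρ => ?_⟩
  have h1 := mul_tangent_nonneg_of_convexOn_entropy hkpos hd hconv one_pos hρ
    (show (0:ℝ) < 1 / 2 by norm_num)
  have h2 := mul_tangent_nonneg_of_convexOn_entropy hkpos hd hconv one_pos hρ two_pos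
  linarith

theorem second_deriv_eq_zero_iff_affine {k k' k'' : ℝ → ℝ}
    (hd1 : ∀ ρ > (0:ℝ), HasDerivAt k (k' ρ) ρ)
    (hd2 : ∀ ρ > (0:ℝ), HasDerivAt k' (k'' ρ) ρ) :
    (∀ ρ > (0:ℝ), k'' ρ = 0) ↔ ∃ a b : ℝ, ∀ ρ > (0:ℝ), k ρ = a * ρ + b := by
  constructor
  · intro h
    obtain ⟨a, ha⟩ := isOpen_Ioi.exists_is_const_of_deriv_eq_zero
      (convex_Ioi (0:ℝ)).isPreconnected
      (fun ρ hρ => (hd2 ρ hρ).differentiableAt.differentiableWithinAt)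
      (fun ρ hρ => (hd2 ρ hρ).deriv.trans (h ρ hρ))
    have hd (ρ : ℝ) (hρ : 0 < ρ) : HasDerivAt (fun r => k r - a * r) 0 ρ := by
      simpa [ha ρ hρ] using (hd1 ρ hρ).fun_sub ((hasDerivAt_id ρ).const_mul a)
    obtain ⟨b, hb⟩ := isOpen_Ioi.exists_is_const_of_deriv_eq_zero
      (convex_Ioi (0:ℝ)).isPreconnected
      (fun ρ hρ => (hd ρ hρ).differentiableAt.differentiableWithinAt)
      (fun ρ hρ => (hd ρ hρ).deriv)
    exact ⟨a, b, fun ρ hρ => by linarith [hb ρ hρ]⟩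
  · rintro ⟨a, b, hk⟩ ρ hρ
    have hk' (r : ℝ) (hr : 0 < r) : k' r = a := by
      refine (hd1 r hr).unique (HasDerivAt.congr_of_eventuallyEq
        (f := fun r => a * r + b) ?_ ?_)
      · simpa using ((hasDerivAt_id r).const_mul a).add_const b
      · filter_upwards [Ioi_mem_nhds hr] with s hs using hk s hs
    refine (hd2 ρ hρ).unique ((hasDerivAt_const ρ a).congr_of_eventuallyEq ?_)
    filter_upwards [Ioi_mem_nhds hρ] with s hs using hk' s hs

/-- for a twice continuously differentiable rate `k : (0,∞) → (0,∞)` (with first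
and second derivatives `k'`, `k''`), the function `f(ρ,q) = q log(q/k(ρ)) - q + k(ρ)` is jointly
convex on `(0,∞) × (0,∞)` if and only if `k'' ≡ 0` on `(0,∞)`, i.e. if and only if `k` is
affine on `(0,∞)`. -/
theorem jointly_convex_iff_affine (k k' k'' : ℝ → ℝ)
    (hkpos : ∀ ρ > (0:ℝ), 0 < k ρ)
    (hd1 : ∀ ρ > (0:ℝ), HasDerivAt k (k' ρ) ρ)
    (hd2 : ∀ ρ > (0:ℝ), HasDerivAt k' (k'' ρ) ρ)
    (hcont : ContinuousOn k'' (Set.Ioi 0)) :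
    (ConvexOn ℝ (Set.Ioi (0:ℝ) ×ˢ Set.Ioi (0:ℝ))
        (fun p : ℝ × ℝ => p.2 * Real.log (p.2 / k p.1) - p.2 + k p.1) ↔
      ∀ ρ > (0:ℝ), k'' ρ = 0) ∧
    (ConvexOn ℝ (Set.Ioi (0:ℝ) ×ˢ Set.Ioi (0:ℝ))
        (fun p : ℝ × ℝ => p.2 * Real.log (p.2 / k p.1) - p.2 + k p.1) ↔
      ∃ a b : ℝ, ∀ ρ > (0:ℝ), k ρ = a * ρ + b) := by
  have h : ConvexOn ℝ (Set.Ioi (0:ℝ) ×ˢ Set.Ioi (0:ℝ))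
      (fun p : ℝ × ℝ => p.2 * Real.log (p.2 / k p.1) - p.2 + k p.1) ↔
      ∃ a b : ℝ, ∀ ρ > (0:ℝ), k ρ = a * ρ + b :=
    ⟨affine_of_convexOn_entropy hkpos (hd1 1 one_pos),
      fun ⟨_, _, hk⟩ => convexOn_entropy_of_affine hkpos hk⟩
  exact ⟨h.trans (second_deriv_eq_zero_iff_affine hd1 hd2).symm, h⟩
end

section
/- Let κ : (0,∞) → (0,∞) be continuous and strictly increasing, L ≥ 2 an integer, m > 0, and let ρ : I → (0,∞)^{ℤ/Lℤ} be a differentiable solution on an interval I of the ring equations ρ̇_x(t) = Lκ(ρ_{x−1}(t)) − Lκ(ρ_x(t)) for all x ∈ ℤ/Lℤ. Define V_m(ρ) := (1/m) Σ_{x∈ℤ/Lℤ} ∫_{m/L}^{ρ_x} log κ(α) dα. Then for every t ∈ I, (d/dt) V_m(ρ(t)) = −(L/m) Σ_{x∈ℤ/Lℤ} s(κ(ρ_x(t)) | κ(ρ_{x+1}(t))) ≤ 0; in particular V_m is non-increasing along solutions. -/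
/-- The entropy function is nonnegative on positive arguments. -/
theorem sR_nonneg {a b : ℝ} (ha : 0 < a) (hb : 0 < b) : 0 ≤ sR a b := by
  have hlog := Real.log_le_sub_one_of_pos (div_pos hb ha)
  have hinv : Real.log (a / b) = -Real.log (b / a) := by
    rw [← Real.log_inv, inv_div]
  have hmul := mul_le_mul_of_nonneg_left hlog ha.le
  have hcancel : a * (b / a - 1) = b - a := by field_simp
  rw [sR, hinv]
  linarith

/-- On a ring, the sum of the entropies of neighbouring values is the discrete dissipation
`∑ x, log (f x) * (f x - f (x - 1))`. -/
theorem sum_sR_add_one {L : ℕ} [NeZero L] {f : ZMod L → ℝ} (hf : ∀ x, 0 < f x) :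
    ∑ x, sR (f x) (f (x + 1)) = ∑ x, Real.log (f x) * (f x - f (x - 1)) := by
  have hshift : ∑ x, f (x + 1) = ∑ x, f x := Equiv.sum_comp (Equiv.addRight 1) f
  have hcross : ∑ x, f x * Real.log (f (x + 1)) = ∑ x, Real.log (f x) * f (x - 1) := by
    rw [← Equiv.sum_comp (Equiv.addRight (1 : ZMod L)) fun x => Real.log (f x) * f (x - 1)]
    simp [mul_comm]
  have hterm : ∀ x, sR (f x) (f (x + 1)) =
      Real.log (f x) * f x - f x * Real.log (f (x + 1)) - f x + f (x + 1) := fun x => by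
    rw [sR, Real.log_div (hf x).ne' (hf (x + 1)).ne']
    ring
  simp only [hterm, mul_sub, Finset.sum_add_distrib, Finset.sum_sub_distrib, hshift, hcross]
  ring

/-- The fundamental theorem of calculus for an integrand continuous on `(0, ∞)`. -/
theorem hasDerivAt_integral_of_continuousOn_Ioi {f : ℝ → ℝ} (hf : ContinuousOn f (Set.Ioi 0))
    {a b : ℝ} (ha : 0 < a) (hb : 0 < b) :
    HasDerivAt (fun u => ∫ x in a..u, f x) (f b) b := by
  have hsub : Set.uIcc a b ⊆ Set.Ioi 0 := Set.ordConnected_Ioi.uIcc_subset ha hb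
  exact intervalIntegral.integral_hasDerivAt_right (hf.mono hsub).intervalIntegrable
    (hf.stronglyMeasurableAtFilter isOpen_Ioi b hb) (hf.continuousAt (Ioi_mem_nhds hb))

/-- for `κ : (0,∞) → (0,∞)` continuous and strictly increasing and a positive
differentiable solution `ρ` of the ring equations `ρ̇_x = Lκ(ρ_{x-1}) - Lκ(ρ_x)` on an interval
`I`, the Lyapunov functional `V_m(ρ) = (1/m) Σ_x ∫_{m/L}^{ρ_x} log κ(α) dα` satisfies
`(d/dt) V_m(ρ(t)) = -(L/m) Σ_x s(κ(ρ_x(t)) | κ(ρ_{x+1}(t))) ≤ 0` for every `t ∈ I`;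
in particular `V_m` is non-increasing along solutions. -/
theorem lyapunov_decreases (L : ℕ) [NeZero L] (hL : 2 ≤ L)
    (m : ℝ) (hm : 0 < m)
    (κ : ℝ → ℝ) (hκpos : ∀ a > (0:ℝ), 0 < κ a)
    (hκc : ContinuousOn κ (Set.Ioi 0)) (hκmono : StrictMonoOn κ (Set.Ioi 0))
    (I : Set ℝ) (ρ : ℝ → ZMod L → ℝ)
    (hρpos : ∀ t ∈ I, ∀ x, 0 < ρ t x)
    (hsol : ∀ x : ZMod L, ∀ t ∈ I,
      HasDerivAt (fun u => ρ u x) ((L : ℝ) * κ (ρ t (x - 1)) - (L : ℝ) * κ (ρ t x)) t) :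
    ∀ t ∈ I,
      HasDerivAt
        (fun u => (1 / m) * ∑ x : ZMod L, ∫ α in (m / (L : ℝ))..(ρ u x), Real.log (κ α))
        (-((L : ℝ) / m) * ∑ x : ZMod L, sR (κ (ρ t x)) (κ (ρ t (x + 1)))) t ∧
      -((L : ℝ) / m) * ∑ x : ZMod L, sR (κ (ρ t x)) (κ (ρ t (x + 1))) ≤ 0 := by
  intro t ht
  have hκρ : ∀ x, 0 < κ (ρ t x) := fun x => hκpos _ (hρpos t ht x)
  have hLpos : (0 : ℝ) < L := by exact_mod_cast NeZero.pos L
  have hlog : ContinuousOn (fun α => Real.log (κ α)) (Set.Ioi 0) :=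
    hκc.log fun α hα => (hκpos α hα).ne'
  refine ⟨?_, ?_⟩
  · have hderiv := (HasDerivAt.fun_sum (u := Finset.univ) fun (x : ZMod L) _ =>
      (hasDerivAt_integral_of_continuousOn_Ioi hlog (div_pos hm hLpos)
        (hρpos t ht x)).comp t (hsol x t ht)).const_mul (1 / m)
    refine hderiv.congr_deriv ?_
    rw [sum_sR_add_one hκρ, Finset.mul_sum, Finset.mul_sum]
    refine Finset.sum_congr rfl fun x _ => ?_
    ring
  · exact mul_nonpos_of_nonpos_of_nonneg (neg_nonpos.mpr (div_pos hLpos hm).le)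
      (Finset.sum_nonneg fun x _ => sR_nonneg (hκρ x) (hκρ (x + 1)))
end

section
/- Convergence of the discretised cost: let μ ≥ 0, τ > 0, let Φ : ℝ → ℝ be continuous, 1-periodic, with Φ(u) ≥ c for all u for some constant c > 0, and let κ : [0,∞) → [0,∞) be continuous with κ > 0 on (0,∞). Then lim_{L→∞} ∫_0^1 s(Φ(u) | κ(μ + τ L ∫_{u−1/L}^{u} Φ(z) dz)) du = ∫_0^1 s(Φ(u) | κ(μ + τΦ(u))) du. -/
theorem Continuous.exists_eq_mul_integral {Φ : ℝ → ℝ} (hΦ : Continuous Φ) {L : ℝ} (hL : 0 < L)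
    (u : ℝ) : ∃ ξ ∈ Set.Ioo (u - 1 / L) u, Φ ξ = L * ∫ z in (u - 1 / L)..u, Φ z := by
  have hlt : u - 1 / L < u := sub_lt_self u (by positivity)
  have hderiv : ∀ x, HasDerivAt (fun x => ∫ z in (u - 1 / L)..x, Φ z) (Φ x) x := fun x =>
    intervalIntegral.integral_hasDerivAt_right (hΦ.intervalIntegrable _ _)
      (hΦ.stronglyMeasurableAtFilter _ _) hΦ.continuousAt
  obtain ⟨ξ, hξ, h⟩ := exists_hasDerivAt_eq_slope _ Φ hlt
    (fun x _ => (hderiv x).continuousAt.continuousWithinAt) (fun x _ => hderiv x)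
  refine ⟨ξ, hξ, ?_⟩
  rw [h, intervalIntegral.integral_same]
  field_simp
  ring

theorem Continuous.tendsto_mul_integral {Φ : ℝ → ℝ} (hΦ : Continuous Φ) (u : ℝ) :
    Filter.Tendsto (fun L : ℕ => (L : ℝ) * ∫ z in (u - 1 / (L : ℝ))..u, Φ z)
      Filter.atTop (nhds (Φ u)) := by
  have hpos : ∀ L : ℕ, (0 : ℝ) < (L + 1 : ℕ) := fun L => by positivity
  choose ξ hξ h using fun L : ℕ => hΦ.exists_eq_mul_integral (hpos L) u
  rw [← Filter.tendsto_add_atTop_iff_nat 1]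
  simp_rw [← h]
  refine (hΦ.tendsto u).comp (tendsto_of_tendsto_of_tendsto_of_le_of_le ?_ tendsto_const_nhds
    (fun L => (hξ L).1.le) (fun L => (hξ L).2.le))
  have := (tendsto_const_nhds (x := u)).sub (tendsto_one_div_add_atTop_nhds_zero_nat (𝕜 := ℝ))
  simpa using this

theorem continuousOn_sR : ContinuousOn (fun p : ℝ × ℝ => sR p.1 p.2)
    (Set.Ioi 0 ×ˢ Set.Ioi 0) := by
  unfold sR
  have hdiv : ContinuousOn (fun p : ℝ × ℝ => p.1 / p.2) (Set.Ioi 0 ×ˢ Set.Ioi 0) :=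
    continuousOn_fst.div continuousOn_snd fun p hp => ne_of_gt hp.2
  exact ((continuousOn_fst.mul (hdiv.log fun p hp => (div_pos hp.1 hp.2).ne')).sub
    continuousOn_fst).add continuousOn_snd

/-- convergence of the discretised cost: for `μ ≥ 0`, `τ > 0`, a continuous
`1`-periodic `Φ : ℝ → ℝ` bounded below by `c > 0`, and `κ : [0,∞) → [0,∞)` continuous with
`κ > 0` on `(0,∞)`,
`∫₀¹ s(Φ(u) | κ(μ + τ L ∫_{u-1/L}^u Φ(z) dz)) du → ∫₀¹ s(Φ(u) | κ(μ + τΦ(u))) du`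
as `L → ∞`. -/
theorem discretised_cost_tendsto (κ : ℝ → ℝ)
    (hκc : ContinuousOn κ (Set.Ici 0))
    (hκnn : ∀ a ∈ Set.Ici (0:ℝ), 0 ≤ κ a)
    (hκpos : ∀ a > (0:ℝ), 0 < κ a)
    (μ τ c : ℝ) (hμ : 0 ≤ μ) (hτ : 0 < τ) (hc : 0 < c)
    (Φ : ℝ → ℝ) (hΦc : Continuous Φ) (hΦper : Function.Periodic Φ 1)
    (hΦlb : ∀ u, c ≤ Φ u) :
    Filter.Tendsto
      (fun L : ℕ => ∫ u in (0:ℝ)..1,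
        sR (Φ u) (κ (μ + τ * ((L : ℝ) * ∫ z in (u - 1 / (L : ℝ))..u, Φ z))))
      Filter.atTop
      (nhds (∫ u in (0:ℝ)..1, sR (Φ u) (κ (μ + τ * Φ u)))) := by
  have hpos : ∀ x > (0 : ℝ), 0 < μ + τ * x := fun x hx => by positivity
  have hG : ContinuousOn (fun p : ℝ × ℝ => sR p.1 (κ (μ + τ * p.2)))
      (Set.Ioi 0 ×ˢ Set.Ioi 0) := by
    refine continuousOn_sR.comp (continuousOn_fst.prodMk (hκc.comp
      (f := fun p : ℝ × ℝ => μ + τ * p.2) (by fun_prop) fun p hp => (hpos _ hp.2).le))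
      fun p hp => ⟨hp.1, hκpos _ (hpos _ hp.2)⟩
  obtain ⟨M, hM⟩ := (hΦper.compact_of_continuous one_ne_zero hΦc).bddAbove
  have hΦmem : ∀ u, Φ u ∈ Set.Icc c M := fun u => ⟨hΦlb u, hM ⟨u, rfl⟩⟩
  have hsub : Set.Icc c M ×ˢ Set.Icc c M ⊆ Set.Ioi (0 : ℝ) ×ˢ Set.Ioi (0 : ℝ) :=
    fun p hp => ⟨hc.trans_le hp.1.1, hc.trans_le hp.2.1⟩
  obtain ⟨C, hC⟩ := (isCompact_Icc.prod isCompact_Icc).exists_bound_of_continuousOn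
    (hG.mono hsub)
  have hmem : ∀ᶠ L : ℕ in Filter.atTop, ∀ u,
      (Φ u, (L : ℝ) * ∫ z in (u - 1 / (L : ℝ))..u, Φ z) ∈ Set.Icc c M ×ˢ Set.Icc c M := by
    filter_upwards [Filter.eventually_gt_atTop 0] with L hL u
    obtain ⟨ξ, -, h⟩ := hΦc.exists_eq_mul_integral (Nat.cast_pos.2 hL : (0 : ℝ) < L) u
    exact ⟨hΦmem u, h ▸ hΦmem ξ⟩
  refine intervalIntegral.tendsto_integral_filter_of_dominated_convergence (fun _ => C) ?_ ?_
    intervalIntegrable_const ?_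
  · filter_upwards [hmem] with L hL
    have hprim : Continuous fun x => ∫ z in (0 : ℝ)..x, Φ z :=
      intervalIntegral.continuous_primitive (fun a b => hΦc.intervalIntegrable a b) 0
    have havg : Continuous fun u => (L : ℝ) * ∫ z in (u - 1 / (L : ℝ))..u, Φ z := by
      have hsplit := fun u : ℝ => intervalIntegral.integral_interval_sub_left
        (hΦc.intervalIntegrable 0 u) (hΦc.intervalIntegrable (μ := MeasureTheory.volume)
          0 (u - 1 / (L : ℝ)))
      refine continuous_const.mul (Continuous.congr ?_ hsplit)
      exact hprim.sub (hprim.comp (continuous_id.sub continuous_const))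
    exact (hG.comp_continuous (hΦc.prodMk havg) fun u => hsub (hL u)).aestronglyMeasurable
  · filter_upwards [hmem] with L hL
    exact Filter.Eventually.of_forall fun u _ => hC _ (hL u)
  · refine Filter.Eventually.of_forall fun u _ => ?_
    have hu : (Φ u, Φ u) ∈ Set.Ioi (0 : ℝ) ×ˢ Set.Ioi (0 : ℝ) := hsub ⟨hΦmem u, hΦmem u⟩
    exact (hG.continuousAt ((isOpen_Ioi.prod isOpen_Ioi).mem_nhds hu)).tendsto.comp
      (tendsto_const_nhds.prodMk_nhds (hΦc.tendsto_mul_integral u))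
end

section
/- For the Young function κ(ρ) := (ρ+1) log(ρ+1) − ρ, the following hold: (a) κ is strictly convex on (0,∞) and log ∘ κ is strictly concave on (0,∞); consequently, for every q̄ > 0 and L > 0 the function ρ ↦ L s(q̄ | Lκ(ρ)) is strictly convex on (0,∞); (b) there exists δ > 0 such that the function φ ↦ s(φ | κ(φ)) is strictly concave on (0,δ); indeed its second derivative H(φ) satisfies H(1) < 0 and H(φ) → −∞ as φ → 0⁺. -/
/-- The classical Young function `κ(ρ) = (ρ+1)log(ρ+1) - ρ`. -/
noncomputable def youngK (ρ : ℝ) : ℝ := (ρ + 1) * Real.log (ρ + 1) - ρ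

open Filter Topology Set

/-- The first derivative of `φ ↦ s(φ | κ(φ))` on `(0,∞)`. -/
noncomputable def entropyDeriv (x : ℝ) : ℝ :=
  Real.log (x / youngK x) - x * Real.log (x + 1) / youngK x + Real.log (x + 1)

/-- The second derivative of `φ ↦ s(φ | κ(φ))` on `(0,∞)`. -/
noncomputable def entropyDeriv2 (x : ℝ) : ℝ :=
  1 / x - 2 * Real.log (x + 1) / youngK x - x * (1 / (x + 1)) / youngK x
    + x * Real.log (x + 1) ^ 2 / youngK x ^ 2 + 1 / (x + 1)

lemma hasDerivAt_log_add_one {x : ℝ} (hx : -1 < x) :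
    HasDerivAt (fun y : ℝ => Real.log (y + 1)) (1 / (x + 1)) x :=
  ((hasDerivAt_id x).add_const 1).log (by simp only [id]; linarith)

lemma hasDerivAt_youngK {x : ℝ} (hx : -1 < x) :
    HasDerivAt youngK (Real.log (x + 1)) x := by
  have h := (((hasDerivAt_id x).add_const 1).mul (hasDerivAt_log_add_one hx)).sub (hasDerivAt_id x)
  refine h.congr_deriv ?_
  have : x + 1 ≠ 0 := by linarith
  simp only [id]
  field_simp
  ring

lemma log_add_one_pos {x : ℝ} (hx : 0 < x) : 0 < Real.log (x + 1) :=
  Real.log_pos (by linarith)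

lemma youngK_pos {x : ℝ} (hx : 0 < x) : 0 < youngK x := by
  have h := Real.log_lt_sub_one_of_pos (x := (x + 1)⁻¹) (by positivity)
    (by rw [Ne, inv_eq_one]; linarith)
  rw [Real.log_inv] at h
  have h2 : (x + 1) * (x + 1)⁻¹ = 1 := mul_inv_cancel₀ (by linarith)
  unfold youngK
  nlinarith

lemma deriv_youngK_eqOn : EqOn (deriv youngK) (fun x => Real.log (x + 1)) (Ioi 0) :=
  fun x (hx : 0 < x) => (hasDerivAt_youngK (by linarith)).deriv

lemma strictConvexOn_youngK : StrictConvexOn ℝ (Ioi 0) youngK := by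
  apply StrictMonoOn.strictConvexOn_of_deriv (convex_Ioi 0)
  · exact fun x (hx : 0 < x) =>
      (hasDerivAt_youngK (by linarith)).continuousAt.continuousWithinAt
  · rw [interior_Ioi]
    intro x hx y hy hxy
    rw [deriv_youngK_eqOn hx, deriv_youngK_eqOn hy]
    have hx' : 0 < x := hx
    exact Real.log_lt_log (by linarith) (by linarith)

lemma youngK_lt_mul_log_sq {x : ℝ} (hx : 0 < x) :
    youngK x < (x + 1) * Real.log (x + 1) ^ 2 := by
  have hl := log_add_one_pos hx
  have hq := Real.quadratic_le_exp_of_nonneg hl.le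
  rw [Real.exp_log (by linarith)] at hq
  unfold youngK
  set l := Real.log (x + 1)
  have h1 : 0 < 1 - l + l ^ 2 := by nlinarith [sq_nonneg (l - 1)]
  have h2 := mul_le_mul_of_nonneg_right hq h1.le
  have h3 : (1 + l + l ^ 2 / 2) * (1 - l + l ^ 2) = 1 + l ^ 2 / 2 + l ^ 3 / 2 + l ^ 4 / 2 := by
    ring
  have h4 : 0 < l ^ 2 / 2 + l ^ 3 / 2 + l ^ 4 / 2 := by positivity
  nlinarith

lemma deriv_log_youngK_eqOn :
    EqOn (deriv fun x => Real.log (youngK x)) (fun x => Real.log (x + 1) / youngK x) (Ioi 0) :=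
  fun x (hx : 0 < x) => ((hasDerivAt_youngK (by linarith)).log (youngK_pos hx).ne').deriv

lemma strictConcaveOn_log_youngK :
    StrictConcaveOn ℝ (Ioi 0) (fun x => Real.log (youngK x)) := by
  apply strictConcaveOn_of_deriv2_neg (convex_Ioi 0)
  · exact fun x (hx : 0 < x) => ((hasDerivAt_youngK (by linarith)).log
      (youngK_pos hx).ne').continuousAt.continuousWithinAt
  · rw [interior_Ioi]
    intro x (hx : 0 < x)
    have hk := youngK_pos hx
    have h := (hasDerivAt_log_add_one (by linarith)).div
      (hasDerivAt_youngK (x := x) (by linarith)) hk.ne'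
    simp only [Function.iterate_succ, Function.iterate_zero, Function.comp_apply, id]
    rw [(deriv_log_youngK_eqOn.eventuallyEq_of_mem (Ioi_mem_nhds hx)).deriv_eq]
    refine h.deriv.trans_lt (div_neg_of_neg_of_pos ?_ (by positivity))
    have h1 := youngK_lt_mul_log_sq hx
    have h2 : 1 / (x + 1) * youngK x < Real.log (x + 1) ^ 2 := by
      rw [one_div_mul_eq_div, div_lt_iff₀ (by linarith)]
      linarith
    linarith

lemma strictConvexOn_mul_sR_youngK {q L : ℝ} (hq : 0 < q) (hL : 0 < L) :
    StrictConvexOn ℝ (Ioi 0) (fun x => L * sR q (L * youngK x)) := by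
  refine ⟨convex_Ioi 0, fun x hx y hy hxy a b ha hb hab => ?_⟩
  have hz : a • x + b • y ∈ Ioi (0 : ℝ) := convex_Ioi 0 hx hy ha.le hb.le hab
  have h1 := strictConvexOn_youngK.2 hx hy hxy ha hb hab
  have h2 := strictConcaveOn_log_youngK.2 hx hy hxy ha hb hab
  have key : ∀ z ∈ Ioi (0 : ℝ), L * sR q (L * youngK z) =
      L * q * (Real.log q - Real.log L - 1) + (L ^ 2 * youngK z - L * q * Real.log (youngK z)) := by
    intro z hz
    have hk := youngK_pos hz
    rw [sR, Real.log_div hq.ne' (by positivity), Real.log_mul hL.ne' hk.ne']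
    ring
  simp only [key _ hx, key _ hy, key _ hz]
  simp only [smul_eq_mul] at h1 h2 ⊢
  have h3 := mul_lt_mul_of_pos_left h1 (by positivity : 0 < L ^ 2)
  have h4 := mul_lt_mul_of_pos_left h2 (by positivity : 0 < L * q)
  obtain rfl : b = 1 - a := by linarith
  linarith

lemma hasDerivAt_log_div_youngK {x : ℝ} (hx : 0 < x) :
    HasDerivAt (fun y => Real.log (y / youngK y)) (1 / x - Real.log (x + 1) / youngK x) x := by
  have hk := youngK_pos hx
  refine (((hasDerivAt_id x).div (hasDerivAt_youngK (by linarith)) hk.ne').log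
    (div_pos hx hk).ne').congr_deriv ?_
  simp only [id, Pi.div_apply]
  field_simp

lemma hasDerivAt_sR_youngK {x : ℝ} (hx : 0 < x) :
    HasDerivAt (fun y => sR y (youngK y)) (entropyDeriv x) x := by
  have hk := youngK_pos hx
  refine ((((hasDerivAt_id x).mul (hasDerivAt_log_div_youngK hx)).sub (hasDerivAt_id x)).add
    (hasDerivAt_youngK (by linarith))).congr_deriv ?_
  simp only [id, entropyDeriv]
  field_simp
  ring

lemma hasDerivAt_entropyDeriv {x : ℝ} (hx : 0 < x) :
    HasDerivAt entropyDeriv (entropyDeriv2 x) x := by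
  have hk := youngK_pos hx
  have hl := hasDerivAt_log_add_one (x := x) (by linarith)
  refine (((hasDerivAt_log_div_youngK hx).sub (((hasDerivAt_id x).mul hl).div
    (hasDerivAt_youngK (by linarith)) hk.ne')).add hl).congr_deriv ?_
  simp only [id, entropyDeriv2, Pi.mul_apply]
  field_simp
  ring

lemma deriv_deriv_sR_youngK {x : ℝ} (hx : 0 < x) :
    deriv (deriv fun y => sR y (youngK y)) x = entropyDeriv2 x := by
  have h : EqOn (deriv fun y => sR y (youngK y)) entropyDeriv (Ioi 0) :=
    fun y hy => (hasDerivAt_sR_youngK hy).deriv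
  rw [(h.eventuallyEq_of_mem (Ioi_mem_nhds hx)).deriv_eq]
  exact (hasDerivAt_entropyDeriv hx).deriv

lemma entropyDeriv2_one_neg : entropyDeriv2 1 < 0 := by
  have h1 := Real.log_two_gt_d9
  have h2 := Real.log_two_lt_d9
  have hk : youngK 1 = 2 * Real.log 2 - 1 := by norm_num [youngK]
  have hl : (1 : ℝ) + 1 = 2 := by norm_num
  rw [entropyDeriv2, hk, hl]
  set l := Real.log 2
  have hp : 0 < 2 * l - 1 := by linarith
  have e : 1 / 1 - 2 * l / (2 * l - 1) - 1 * (1 / 2) / (2 * l - 1)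
      + 1 * l ^ 2 / (2 * l - 1) ^ 2 + 1 / 2 = (3 * l - 2) * (l - 1) / (2 * l - 1) ^ 2 := by
    field_simp
    ring
  rw [e]
  exact div_neg_of_neg_of_pos (mul_neg_of_pos_of_neg (by linarith) (by linarith)) (by positivity)

lemma tendsto_log_add_one_div :
    Tendsto (fun x : ℝ => Real.log (x + 1) / x) (𝓝[>] 0) (𝓝 1) := by
  have h := (hasDerivAt_log_add_one (x := 0) (by norm_num)).tendsto_slope
  have h' := h.mono_left (nhdsWithin_mono 0 fun x (hx : 0 < x) => hx.ne' : 𝓝[>] (0 : ℝ) ≤ 𝓝[≠] 0)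
  simpa [slope_fun_def, div_eq_inv_mul] using h'

lemma tendsto_youngK_div_sq :
    Tendsto (fun x : ℝ => youngK x / x ^ 2) (𝓝[>] 0) (𝓝 (1 / 2)) := by
  have hpos : ∀ᶠ x : ℝ in 𝓝[>] 0, 0 < x := self_mem_nhdsWithin
  refine HasDerivAt.lhopital_zero_nhdsGT (f' := fun x => Real.log (x + 1)) (g' := fun x => 2 * x)
    ?_ ?_ ?_ ?_ ?_ ?_
  · filter_upwards [hpos] with x hx using hasDerivAt_youngK (by linarith)
  · filter_upwards [hpos] with x hx
    simpa using hasDerivAt_pow 2 x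
  · filter_upwards [hpos] with x hx
    positivity
  · have h := (hasDerivAt_youngK (x := 0) (by norm_num)).continuousAt.tendsto
    have h0 : youngK 0 = 0 := by simp [youngK]
    rw [h0] at h
    exact h.mono_left nhdsWithin_le_nhds
  · have h : Tendsto (fun x : ℝ => x ^ 2) (𝓝 0) (𝓝 (0 ^ 2)) := (continuous_pow 2).tendsto 0
    rw [zero_pow two_ne_zero] at h
    exact h.mono_left nhdsWithin_le_nhds
  · have h := tendsto_log_add_one_div.div_const 2
    refine h.congr fun x => ?_
    rw [div_div, mul_comm]

lemma tendsto_entropyDeriv2 : Tendsto entropyDeriv2 (𝓝[>] 0) atBot := by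
  have hc : Tendsto (fun x : ℝ => 1 / (x + 1)) (𝓝[>] 0) (𝓝 1) := by
    have h : ContinuousAt (fun x : ℝ => 1 / (x + 1)) 0 :=
      continuousAt_const.div (by fun_prop) (by norm_num)
    have h' := h.tendsto
    norm_num at h'
    simpa using h'.mono_left nhdsWithin_le_nhds
  have hid : Tendsto (fun x : ℝ => x) (𝓝[>] 0) (𝓝 0) := tendsto_id.mono_left nhdsWithin_le_nhds
  have hl := tendsto_log_add_one_div
  have hk := tendsto_youngK_div_sq
  have h2 : (1 / 2 : ℝ) ≠ 0 := by norm_num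
  have hr := hl.div hk h2
  have hlim := ((((tendsto_const_nhds (x := (1 : ℝ))).sub (hr.const_mul 2)).sub
    (hc.div hk h2)).add (hr.pow 2)).add (hid.mul hc)
  have hm := hlim.neg_mul_atTop (by norm_num) tendsto_inv_nhdsGT_zero
  refine hm.congr' ?_
  filter_upwards [self_mem_nhdsWithin] with x (hx : 0 < x)
  have hkx := youngK_pos hx
  simp only [entropyDeriv2, Pi.div_apply]
  field_simp

lemma exists_strictConcaveOn_sR_youngK :
    ∃ δ > (0 : ℝ), StrictConcaveOn ℝ (Ioo 0 δ) (fun x => sR x (youngK x)) := by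
  have h := tendsto_entropyDeriv2.eventually (eventually_lt_atBot 0)
  obtain ⟨δ, hδ, hsub⟩ := mem_nhdsGT_iff_exists_Ioo_subset.1 h
  refine ⟨δ, hδ, strictConcaveOn_of_deriv2_neg (convex_Ioo 0 δ) ?_ ?_⟩
  · exact fun x hx => (hasDerivAt_sR_youngK hx.1).continuousAt.continuousWithinAt
  · rw [interior_Ioo]
    intro x hx
    simp only [Function.iterate_succ, Function.iterate_zero, Function.comp_apply, id]
    rw [deriv_deriv_sR_youngK hx.1]
    exact hsub hx

/-- for the Young function `κ(ρ) = (ρ+1)log(ρ+1) - ρ`: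
(a) `κ` is strictly convex and `log ∘ κ` is strictly concave on `(0,∞)`; consequently, for
every `q̄ > 0` and `L > 0` the function `ρ ↦ L s(q̄ | Lκ(ρ))` is strictly convex on `(0,∞)`;
(b) there is `δ > 0` such that `φ ↦ s(φ | κ(φ))` is strictly concave on `(0,δ)`; indeed its
second derivative `H` satisfies `H(1) < 0` and `H(φ) → -∞` as `φ → 0⁺`. -/
theorem young_function_properties :
    (StrictConvexOn ℝ (Set.Ioi 0) youngK ∧
      StrictConcaveOn ℝ (Set.Ioi 0) (fun ρ => Real.log (youngK ρ)) ∧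
      ∀ qbar > (0:ℝ), ∀ L > (0:ℝ),
        StrictConvexOn ℝ (Set.Ioi (0:ℝ)) (fun ρ => L * sR qbar (L * youngK ρ))) ∧
    (∃ δ > (0:ℝ),
      StrictConcaveOn ℝ (Set.Ioo 0 δ) (fun φ => sR φ (youngK φ))) ∧
    deriv (deriv (fun φ => sR φ (youngK φ))) 1 < 0 ∧
    Filter.Tendsto (deriv (deriv (fun φ => sR φ (youngK φ))))
      (nhdsWithin 0 (Set.Ioi 0)) Filter.atBot := by
  refine ⟨⟨strictConvexOn_youngK, strictConcaveOn_log_youngK,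
    fun q hq L hL => strictConvexOn_mul_sR_youngK hq hL⟩, exists_strictConcaveOn_sR_youngK, ?_, ?_⟩
  · rw [deriv_deriv_sR_youngK one_pos]
    exact entropyDeriv2_one_neg
  · refine tendsto_entropyDeriv2.congr' ?_
    filter_upwards [self_mem_nhdsWithin] with x hx using (deriv_deriv_sR_youngK hx).symm
end
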